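/- For the hinge-loss SVM dual problem, the objective admits a global error bound: there exists a constant κ > 0 such that for every α ∈ [0,C]^n, the Euclidean distance from α to the set S of minimizers of D over [0,C]^n satisfies dist(α, S) ≤ κ·‖T(α) − α‖₂, where T(α) = (T₁(α), …, Tₙ(α)) and Tₜ(α) is the coordinate-wise minimizer Tₜ(α) = argmin_{u ∈ [0,C]} D(α + (u − αₜ)eₜ). -/

import Mathlib

open scoped RealInnerProductSpace

/-- The steepness of the descent directions of the subfamilies of a finite family of linear forms
is uniformly bounded. -/
lemma exists_uniform_descent_bound {E ι : Type*} [NormedAddCommGroup E] [NormedSpace ℝ E]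
    [Finite ι] (l : ι → E →L[ℝ] ℝ) :
    ∃ K > (0 : ℝ), ∀ I : Set ι, (∃ u, ∀ i ∈ I, l i u < 0) →
      ∃ u, ‖u‖ ≤ K ∧ ∀ i ∈ I, l i u ≤ -1 := by
  have key : ∀ I : Set ι, ∃ k : ℝ, (∃ u, ∀ i ∈ I, l i u < 0) →
      ∃ u, ‖u‖ ≤ k ∧ ∀ i ∈ I, l i u ≤ -1 := by
    intro I
    by_cases h : ∃ u, ∀ i ∈ I, l i u < 0
    · obtain ⟨u, hu⟩ := h
      obtain ⟨m, hm⟩ := (Set.finite_range fun i => (-l i u)⁻¹).bddAbove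
      refine ⟨‖m • u‖, fun _ => ⟨m • u, le_rfl, fun i hi => ?_⟩⟩
      have h1 : (-l i u)⁻¹ ≤ m := hm ⟨i, rfl⟩
      have h2 : 0 < -l i u := by linarith [hu i hi]
      have h3 : 1 ≤ m * (-l i u) := by
        rwa [inv_le_iff_one_le_mul₀ h2] at h1
      simp only [map_smul, smul_eq_mul]
      linarith
    · exact ⟨0, fun h' => absurd h' h⟩
  choose k hk using key
  obtain ⟨M, hM⟩ := (Set.finite_range k).bddAbove
  refine ⟨max M 1, by positivity, fun I hI => ?_⟩
  obtain ⟨u, hu, hu'⟩ := hk I hI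
  exact ⟨u, hu.trans ((hM ⟨I, rfl⟩).trans (le_max_left _ _)), hu'⟩

/-- Hoffman's error bound for a feasible finite system of linear inequalities. -/
lemma hoffman_error_bound {E ι : Type*} [NormedAddCommGroup E] [NormedSpace ℝ E]
    [ProperSpace E] [Finite ι] (l : ι → E →L[ℝ] ℝ) (b : ι → ℝ)
    (hP : ∃ z, ∀ i, l i z ≤ b i) :
    ∃ κ > (0 : ℝ), ∀ x, ∀ r, 0 ≤ r → (∀ i, l i x - b i ≤ r) →
      ∃ p, (∀ i, l i p ≤ b i) ∧ dist x p ≤ κ * r := by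
  obtain ⟨z, hz⟩ := hP
  obtain ⟨K, hK, hdesc⟩ := exists_uniform_descent_bound l
  refine ⟨2 * K, by positivity, fun x r hr hx => ?_⟩
  let A : Set (E × ℝ) := (Metric.closedBall x (2 * K * r) ×ˢ Set.Icc 0 r) ∩
    {q | ∀ i, l i q.1 - b i ≤ q.2}
  have hA : IsCompact A := by
    refine ((isCompact_closedBall _ _).prod isCompact_Icc).inter_right ?_
    simp only [Set.ofPred_forall]
    exact isClosed_iInter fun i => isClosed_le (by fun_prop) (by fun_prop)
  have hxA : (x, r) ∈ A :=
    ⟨⟨Metric.mem_closedBall_self (by positivity), hr, le_rfl⟩, hx⟩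
  obtain ⟨⟨y, s⟩, ⟨⟨-, hs0, hsr⟩, hys⟩, hmin⟩ :=
    hA.exists_isMinOn ⟨_, hxA⟩ (f := fun q => 2 * K * q.2 + dist q.1 x) (by fun_prop)
  rw [isMinOn_iff] at hmin
  simp only at hs0 hsr
  change ∀ i, l i y - b i ≤ s at hys
  have hle : 2 * K * s + dist y x ≤ 2 * K * r := by simpa using hmin _ hxA
  rcases hs0.eq_or_lt with rfl | hs
  · refine ⟨y, fun i => by linarith [hys i], ?_⟩
    rw [dist_comm]
    linarith
  exfalso
  obtain ⟨u, huK, hu⟩ := hdesc {i | l i y - b i = s} ⟨z - y, fun i hi => by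
    have hi' : l i y - b i = s := hi
    rw [map_sub]
    linarith [hz i]⟩
  have hev : ∀ᶠ ε : ℝ in nhdsWithin 0 (Set.Ioi 0),
      ∀ i, l i (y + ε • u) - b i ≤ s - ε := by
    rw [Filter.eventually_all]
    intro i
    rcases (hys i).eq_or_lt with h | h
    · filter_upwards [self_mem_nhdsWithin] with ε hε
      have h1 := mul_le_mul_of_nonneg_left (hu i h) (le_of_lt hε)
      simp only [map_add, map_smul, smul_eq_mul]
      linarith
    · have hc : Continuous fun ε : ℝ => l i (y + ε • u) - b i - (s - ε) := by fun_prop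
      have h0 : l i (y + (0 : ℝ) • u) - b i - (s - 0) < 0 := by simpa using h
      filter_upwards [nhdsWithin_le_nhds (hc.continuousAt.eventually_lt_const h0)] with ε hε
      linarith
  have hev' : ∀ᶠ ε : ℝ in nhdsWithin 0 (Set.Ioi 0), ε < s :=
    nhdsWithin_le_nhds (eventually_lt_nhds hs)
  obtain ⟨ε, hε, hεs, hε0⟩ := (hev.and (hev'.and self_mem_nhdsWithin)).exists
  have hε0' : 0 < ε := hε0
  have hd : dist (y + ε • u) x ≤ dist y x + ε * K := by
    refine (dist_triangle _ y _).trans ?_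
    rw [dist_self_add_left, norm_smul, Real.norm_of_nonneg hε0'.le, add_comm]
    gcongr
  have hεK : 0 < ε * K := by positivity
  have hmem : (y + ε • u, s - ε) ∈ A := by
    refine ⟨⟨Metric.mem_closedBall.2 ?_, ?_, ?_⟩, hε⟩
    · have : 0 ≤ K * (s - ε) := mul_nonneg hK.le (by linarith)
      linarith
    · change 0 ≤ s - ε
      linarith
    · change s - ε ≤ r
      linarith
  have := hmin _ hmem
  simp only at this
  linarith

/-- On a compact set, the distance to a nonempty set containing the (possibly empty) solution set
of a finite system of linear inequalities is controlled by the residual of the system. -/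
lemma exists_infDist_le_residual {E ι : Type*} [NormedAddCommGroup E] [NormedSpace ℝ E]
    [ProperSpace E] [Fintype ι] (l : ι → E →L[ℝ] ℝ) (b : ι → ℝ) {K S : Set E}
    (hK : IsCompact K) (hS : ∀ z, (∀ i, l i z ≤ b i) → z ∈ S) :
    ∃ κ > (0 : ℝ), ∀ x ∈ K, ∀ r, 0 ≤ r → (∀ i, l i x - b i ≤ r) →
      Metric.infDist x S ≤ κ * r := by
  by_cases hP : ∃ z, ∀ i, l i z ≤ b i
  · obtain ⟨κ, hκ, h⟩ := hoffman_error_bound l b hP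
    refine ⟨κ, hκ, fun x _ r hr hx => ?_⟩
    obtain ⟨p, hp, hxp⟩ := h x r hr hx
    exact (Metric.infDist_le_dist_of_mem (hS p hp)).trans hxp
  · have hpos : ∀ x ∈ K, 0 < ∑ i, max (l i x - b i) 0 := by
      intro x _
      push Not at hP
      obtain ⟨i, hi⟩ := hP x
      exact Finset.sum_pos' (fun _ _ => le_max_right _ _)
        ⟨i, Finset.mem_univ i, lt_max_of_lt_left (by linarith)⟩
    obtain ⟨ε, hε, hεK⟩ := hK.exists_forall_le' (f := fun x => ∑ i, max (l i x - b i) 0)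
      (by fun_prop) hpos
    obtain ⟨M, hM⟩ := hK.bddAbove_image (Metric.continuous_infDist_pt S).continuousOn
    refine ⟨(max M 1) / ε * (Fintype.card ι + 1), by positivity, fun x hx r hr h => ?_⟩
    have h1 : ε ≤ Fintype.card ι * r := by
      refine (hεK x hx).trans ?_
      simpa using Finset.sum_le_card_nsmul Finset.univ _ r fun i _ => max_le (h i) hr
    calc Metric.infDist x S ≤ max M 1 := (hM ⟨x, hx, rfl⟩).trans (le_max_left _ _)
      _ = max M 1 / ε * ε := by field_simp
      _ ≤ max M 1 / ε * ((Fintype.card ι + 1) * r) := by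
        gcongr
        linarith
      _ = _ := by ring

/-- A point of an interval at which a convex quadratic is minimal satisfies the first-order
condition. -/
lemma first_order_of_quadratic_nonneg {m q δ : ℝ}
    (h : ∀ θ ∈ Set.Icc (0 : ℝ) 1, 0 ≤ m * (θ * δ) + q / 2 * (θ * δ) ^ 2) : 0 ≤ m * δ := by
  have hc : Continuous fun θ : ℝ => m * δ + q / 2 * δ ^ 2 * θ := by fun_prop
  have hlim : Filter.Tendsto (fun θ : ℝ => m * δ + q / 2 * δ ^ 2 * θ)
      (nhdsWithin 0 (Set.Ioi 0)) (nhds (m * δ)) := by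
    simpa using (hc.tendsto 0).mono_left nhdsWithin_le_nhds
  refine ge_of_tendsto hlim ?_
  filter_upwards [Ioo_mem_nhdsGT (zero_lt_one (α := ℝ))] with θ hθ
  have h1 := h θ ⟨hθ.1.le, hθ.2.le⟩
  have h2 : m * (θ * δ) + q / 2 * (θ * δ) ^ 2 = θ * (m * δ + q / 2 * δ ^ 2 * θ) := by ring
  rw [h2] at h1
  exact nonneg_of_mul_nonneg_right h1 hθ.1

/-- Second-order expansion of the hinge-loss dual objective. -/
lemma hinge_dual_expansion {n : ℕ} {F : Type*} [NormedAddCommGroup F] [InnerProductSpace ℝ F]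
    (x : Fin n → F) (α β : Fin n → ℝ) :
    (1 / 2) * ‖∑ i, β i • x i‖ ^ 2 - ∑ i, β i =
      (1 / 2) * ‖∑ i, α i • x i‖ ^ 2 - ∑ i, α i
        + ∑ t, (⟪x t, ∑ i, α i • x i⟫ - 1) * (β t - α t)
        + (1 / 2) * ‖∑ i, (β i - α i) • x i‖ ^ 2 := by
  have h1 : ∑ i, β i • x i = ∑ i, α i • x i + ∑ i, (β i - α i) • x i := by
    simp [sub_smul]
  have h2 : ∑ t, (⟪x t, ∑ i, α i • x i⟫ - 1) * (β t - α t) =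
      ⟪∑ i, α i • x i, ∑ i, (β i - α i) • x i⟫ - (∑ i, β i - ∑ i, α i) := by
    rw [inner_sum, ← Finset.sum_sub_distrib, ← Finset.sum_sub_distrib]
    refine Finset.sum_congr rfl fun t _ => ?_
    rw [inner_smul_right, real_inner_comm]
    ring
  rw [h1, norm_add_sq_real, h2]
  ring

/-- Trichotomy for an exact coordinate minimizer `u` of the hinge-loss dual objective: the
complementarity conditions hold up to the step length. -/
lemma hinge_coordinate_trichotomy {n : ℕ} {F : Type*} [NormedAddCommGroup F]
    [InnerProductSpace ℝ F] (x : Fin n → F) {C : ℝ} (α : Fin n → ℝ) (t : Fin n)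
    (hx1 : ‖x t‖ ^ 2 ≤ 1) (hα : α t ∈ Set.Icc 0 C) {u : ℝ} (hu : u ∈ Set.Icc 0 C)
    (hmin : ∀ v ∈ Set.Icc 0 C,
      (1 / 2) * ‖∑ i, Function.update α t u i • x i‖ ^ 2 - ∑ i, Function.update α t u i ≤
      (1 / 2) * ‖∑ i, Function.update α t v i • x i‖ ^ 2 - ∑ i, Function.update α t v i) :
    (α t ≤ |u - α t| ∧ 0 ≤ ⟪x t, ∑ i, α i • x i⟫ - 1) ∨
    |⟪x t, ∑ i, α i • x i⟫ - 1| ≤ |u - α t| ∨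
    (C - α t ≤ |u - α t| ∧ ⟪x t, ∑ i, α i • x i⟫ - 1 ≤ 0) := by
  set g := ⟪x t, ∑ i, α i • x i⟫ - 1 with hg
  set q := ‖x t‖ ^ 2 with hq
  have hq0 : 0 ≤ q := by positivity
  have hsingle : ∀ γ : Fin n → ℝ, ∀ v, ∑ i, Function.update γ t v i • x i =
      ∑ i, γ i • x i + (v - γ t) • x t := by
    intro γ v
    rw [← sub_eq_iff_eq_add', ← Finset.sum_sub_distrib, Finset.sum_eq_single t]
    · simp [sub_smul]
    · intro i _ hi
      simp [hi]
    · simp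
  have hsum : ∀ v, ∑ i, Function.update α t v i = ∑ i, α i + (v - α t) := by
    intro v
    rw [← sub_eq_iff_eq_add', ← Finset.sum_sub_distrib, Finset.sum_eq_single t]
    · simp
    · intro i _ hi
      simp [hi]
    · simp
  have hval : ∀ v, (1 / 2) * ‖∑ i, Function.update α t v i • x i‖ ^ 2
      - ∑ i, Function.update α t v i =
      (1 / 2) * ‖∑ i, α i • x i‖ ^ 2 - ∑ i, α i + g * (v - α t) + q / 2 * (v - α t) ^ 2 := by
    intro v
    rw [hsingle, hsum, norm_add_sq_real, inner_smul_right, norm_smul, mul_pow, Real.norm_eq_abs,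
      sq_abs, real_inner_comm, hg, hq]
    ring
  have hvi : ∀ v ∈ Set.Icc 0 C, 0 ≤ (g + q * (u - α t)) * (v - u) := by
    intro v hv
    refine first_order_of_quadratic_nonneg (q := q) fun θ hθ => ?_
    have hmem : u + θ * (v - u) ∈ Set.Icc 0 C :=
      ((convex_Icc (0 : ℝ) C).add_smul_sub_mem hu hv hθ)
    have := hmin _ hmem
    rw [hval, hval] at this
    linarith
  obtain ⟨hα0, hαC⟩ := hα
  obtain ⟨hu0, huC⟩ := hu
  rcases lt_trichotomy (g + q * (u - α t)) 0 with hm | hm | hm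
  · have hu' : C ≤ u := by
      have := hvi C ⟨hu0.trans huC, le_rfl⟩
      nlinarith
    refine Or.inr (Or.inr ⟨(by linarith : C - α t ≤ u - α t).trans (le_abs_self _), ?_⟩)
    have : 0 ≤ q * (u - α t) := mul_nonneg hq0 (by linarith)
    linarith
  · refine Or.inr (Or.inl ?_)
    rw [show g = -(q * (u - α t)) by linarith, abs_neg, abs_mul, abs_of_nonneg hq0]
    exact mul_le_of_le_one_left (abs_nonneg _) hx1
  · have hu' : u ≤ 0 := by
      have := hvi 0 ⟨le_rfl, hu0.trans huC⟩
      nlinarith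
    refine Or.inl ⟨(by linarith : α t ≤ -(u - α t)).trans (neg_le_abs _), ?_⟩
    have : 0 ≤ q * (α t - u) := mul_nonneg hq0 (by linarith)
    linarith

/-- Linear forms of the system describing the points satisfying the complementarity conditions
with pattern `σ`: coordinate `t` is at the lower bound, free, or at the upper bound when `σ t` is
`-1`, `0` or `1`. The index `(t, false, _)` bounds `α t`, the index `(t, true, _)` bounds the
partial derivative. -/
noncomputable def hingeForm {n : ℕ} {F : Type*} [NormedAddCommGroup F] [InnerProductSpace ℝ F]
    (x : Fin n → F) (σ : Fin n → SignType) :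
    Fin n × Bool × Bool → EuclideanSpace ℝ (Fin n) →L[ℝ] ℝ
  | (t, false, false) => -EuclideanSpace.proj t
  | (t, false, true) => EuclideanSpace.proj t
  | (t, true, false) => (if σ t = 1 then (0 : ℝ) else -1) •
      (innerSL ℝ (x t)).comp (∑ i, (EuclideanSpace.proj i : _ →L[ℝ] ℝ).smulRight (x i))
  | (t, true, true) => (if σ t = -1 then (0 : ℝ) else 1) •
      (innerSL ℝ (x t)).comp (∑ i, (EuclideanSpace.proj i : _ →L[ℝ] ℝ).smulRight (x i))

/-- Right-hand sides of the system with linear forms `hingeForm`. -/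
def hingeBound {n : ℕ} (C : ℝ) (σ : Fin n → SignType) : Fin n × Bool × Bool → ℝ
  | (t, false, false) => if σ t = 1 then -C else 0
  | (t, false, true) => if σ t = -1 then 0 else C
  | (t, true, false) => if σ t = 1 then 0 else -1
  | (t, true, true) => if σ t = -1 then 0 else 1

/-- The residual of the system `hingeForm x σ ≤ hingeBound C σ` is at most `r` exactly when the
complementarity conditions with pattern `σ` hold up to `r`. -/
lemma hingeForm_residual_le_iff {n : ℕ} {F : Type*} [NormedAddCommGroup F]
    [InnerProductSpace ℝ F] (x : Fin n → F) (C : ℝ) (σ : Fin n → SignType)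
    (α : EuclideanSpace ℝ (Fin n)) {r : ℝ} (hr : 0 ≤ r) :
    (∀ j, hingeForm x σ j α - hingeBound C σ j ≤ r) ↔
      ∀ t, (if σ t = 1 then C else 0) - r ≤ α t ∧ α t ≤ (if σ t = -1 then 0 else C) + r ∧
        (σ t ≠ 1 → -r ≤ ⟪x t, ∑ i, α i • x i⟫ - 1) ∧
        (σ t ≠ -1 → ⟪x t, ∑ i, α i • x i⟫ - 1 ≤ r) := by
  simp only [Prod.forall, Bool.forall_bool, hingeForm, hingeBound]
  refine forall_congr' fun t => ?_
  simp only [neg_apply, PiLp.proj_apply, smul_apply,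
    ContinuousLinearMap.comp_apply, sum_apply,
    ContinuousLinearMap.smulRight_apply, innerSL_apply_apply, smul_eq_mul]
  generalize ⟪x t, ∑ i, α i • x i⟫ = γ
  rcases (σ t).trichotomy with h | h | h <;> simp [h, hr] <;> grind

/-- Global error bound for the hinge-loss SVM dual objective
`D(α) = (1/2)‖∑ αᵢxᵢ‖² − ∑ αᵢ` over the box `[0,C]ⁿ`: there is `κ > 0` with
`dist(α, S) ≤ κ‖T(α) − α‖` for all `α ∈ [0,C]ⁿ`, where `S` is the set of minimizers
of `D` over the box and `Tₜ(α)` is the (unique) coordinatewise minimizer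
`argmin_{u ∈ [0,C]} D(α + (u − αₜ)eₜ)`. -/
theorem hinge_svm_global_error_bound
    (n d : ℕ) (hn : 1 ≤ n) (hd : 1 ≤ d)
    (x : Fin n → EuclideanSpace ℝ (Fin d))
    (hx : ∀ i, x i ≠ 0) (hx1 : ∀ i, ‖x i‖ ^ 2 ≤ 1)
    (C : ℝ) (hC : 0 < C)
    (D : EuclideanSpace ℝ (Fin n) → ℝ)
    (hD : ∀ α, D α = (1 / 2) * ‖∑ i, α i • x i‖ ^ 2 - ∑ i, α i)
    (box : Set (EuclideanSpace ℝ (Fin n)))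
    (hbox : box = {α | ∀ i, α i ∈ Set.Icc (0 : ℝ) C})
    (S : Set (EuclideanSpace ℝ (Fin n)))
    (hS : S = {α | α ∈ box ∧ ∀ β ∈ box, D α ≤ D β})
    (T : EuclideanSpace ℝ (Fin n) → EuclideanSpace ℝ (Fin n))
    (hT : ∀ α ∈ box, ∀ t : Fin n,
      T α t ∈ Set.Icc (0 : ℝ) C ∧
      (∀ u ∈ Set.Icc (0 : ℝ) C,
        D ((WithLp.equiv 2 (Fin n → ℝ)).symm (Function.update α t (T α t)))
          ≤ D ((WithLp.equiv 2 (Fin n → ℝ)).symm (Function.update α t u))) ∧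
      (∀ u ∈ Set.Icc (0 : ℝ) C,
        D ((WithLp.equiv 2 (Fin n → ℝ)).symm (Function.update α t u))
          ≤ D ((WithLp.equiv 2 (Fin n → ℝ)).symm (Function.update α t (T α t)))
            → u = T α t)) :
    ∃ κ > (0 : ℝ), ∀ α ∈ box, Metric.infDist α S ≤ κ * ‖T α - α‖ := by
  have hupd : ∀ (α : EuclideanSpace ℝ (Fin n)) t v,
      D ((WithLp.equiv 2 (Fin n → ℝ)).symm (Function.update α t v)) =
      (1 / 2) * ‖∑ i, Function.update α t v i • x i‖ ^ 2 - ∑ i, Function.update α t v i :=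
    fun α t v => hD _
  have hboxc : IsCompact box := by
    have h := (isCompact_univ_pi fun _ : Fin n => isCompact_Icc (a := (0 : ℝ)) (b := C)).image
      (PiLp.continuous_toLp 2 fun _ : Fin n => ℝ)
    convert h using 1
    rw [hbox]
    ext α
    constructor
    · exact fun hα => ⟨α.ofLp, fun i _ => hα i, rfl⟩
    · rintro ⟨β, hβ, rfl⟩ i
      exact hβ i trivial
  have hsub : ∀ σ : Fin n → SignType, ∀ z,
      (∀ j, hingeForm x σ j z ≤ hingeBound C σ j) → z ∈ S := by
    intro σ z hz
    have hz' := (hingeForm_residual_le_iff x C σ z le_rfl).1 fun j => sub_nonpos.2 (hz j)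
    rw [hS, hbox]
    refine ⟨fun t => ?_, fun β hβ => ?_⟩
    · have := hz' t
      rcases h : σ t with _ | _ | _ <;> simp [h] at this <;> constructor <;> linarith
    · rw [hD β, hinge_dual_expansion x z β, ← hD z]
      have hgrad : 0 ≤ ∑ t, (⟪x t, ∑ i, z i • x i⟫ - 1) * (β t - z t) := by
        refine Finset.sum_nonneg fun t _ => ?_
        have h1 := hz' t
        obtain ⟨h2, h3⟩ := hβ t
        rcases h : σ t with _ | _ | _ <;> simp [h] at h1
        · rw [show ⟪x t, ∑ i, z i • x i⟫ - 1 = 0 by linarith, zero_mul]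
        · exact mul_nonneg (by linarith) (by linarith)
        · exact mul_nonneg_of_nonpos_of_nonpos (by linarith) (by linarith)
      have : 0 ≤ (1 / 2) * ‖∑ i, (β i - z i) • x i‖ ^ 2 := by positivity
      linarith
  choose κ hκ hbound using fun σ : Fin n → SignType =>
    exists_infDist_le_residual (hingeForm x σ) (hingeBound C σ) hboxc (hsub σ)
  obtain ⟨M, hM⟩ := (Set.finite_range κ).bddAbove
  refine ⟨max M 1, by positivity, fun α hα => ?_⟩
  have hα' : ∀ t, α t ∈ Set.Icc (0 : ℝ) C := by
    rw [hbox] at hα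
    exact hα
  have hr : ∀ t, |T α t - α t| ≤ ‖T α - α‖ := fun t => PiLp.norm_apply_le (T α - α) t
  have hpattern : ∀ t, ∃ s : SignType,
      (if s = 1 then C else 0) - ‖T α - α‖ ≤ α t ∧
      α t ≤ (if s = -1 then 0 else C) + ‖T α - α‖ ∧
      (s ≠ 1 → -‖T α - α‖ ≤ ⟪x t, ∑ i, α i • x i⟫ - 1) ∧
      (s ≠ -1 → ⟪x t, ∑ i, α i • x i⟫ - 1 ≤ ‖T α - α‖) := by
    intro t
    obtain ⟨hTmem, hTmin, -⟩ := hT α hα t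
    simp only [hupd] at hTmin
    have h0 := norm_nonneg (T α - α)
    obtain ⟨h2, h3⟩ := hα' t
    have h4 := hr t
    rcases hinge_coordinate_trichotomy x α t (hx1 t) (hα' t) hTmem hTmin with h | h | h
    · refine ⟨-1, ?_⟩
      simp
      refine ⟨?_, ?_, ?_⟩ <;> linarith
    · refine ⟨0, ?_⟩
      have h5 := abs_le.1 (h.trans h4)
      simp
      refine ⟨?_, ?_, ?_, ?_⟩ <;> linarith
    · refine ⟨1, ?_⟩
      simp
      refine ⟨?_, ?_, ?_⟩ <;> linarith
  choose σ hσ using hpattern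
  refine (hbound σ α hα _ (norm_nonneg _)
    ((hingeForm_residual_le_iff x C σ α (norm_nonneg _)).2 hσ)).trans ?_
  gcongr
  exact (hM ⟨σ, rfl⟩).trans (le_max_left _ _)
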